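/- Let $2<q,\tilde q<\infty$ and let $\tilde q'$ be the conjugate exponent of $\tilde q$. There exists a constant $C>0$ such that for every $t\in\mathbb{R}$ and every $f\in L^{\tilde q'}(\mathbb{T})$: $\|e^{it\mathcal{L}}f\|_{L^q(\mathbb{T})}\le C\,\|f\|_{L^{\tilde q'}(\mathbb{T})}$ if $|t|\le1$, and $\|e^{it\mathcal{L}}f\|_{L^q(\mathbb{T})}\le C\,|t|^{-3/2}\,\|f\|_{L^{\tilde q'}(\mathbb{T})}$ if $|t|\ge1$. -/

import Mathlib

noncomputable section

open Complex MeasureTheory Filter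
open scoped ENNReal NNReal Topology

/-- A homogeneous tree of degree `Q+1`: a connected acyclic graph in which every
vertex has exactly `Q+1` neighbours. -/
structure HomTree (Q : ℕ) : Type 1 where
  V : Type
  graph : SimpleGraph V
  isTree : graph.IsTree
  regular : ∀ x : V, {y : V | graph.Adj x y}.ncard = Q + 1

/-- `γ(0) = 2/(Q^{1/2} + Q^{-1/2})`. -/
def gammaZero (Q : ℕ) : ℝ := 2 / (Real.sqrt Q + (Real.sqrt Q)⁻¹)

/-- The radial Schrödinger kernel
`s_t(n) = e^{it} (2/π) ∑_{k≥0} Q^{-n/2-k} ∫₀^π e^{-iγ(0)t cos λ} sin λ sin((n+2k+1)λ) dλ`. -/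
def schKernel (Q : ℕ) (t : ℝ) (n : ℕ) : ℂ :=
  Complex.exp (Complex.I * t) * (2 / Real.pi) *
    ∑' k : ℕ, (((Q : ℝ) ^ (-(n : ℝ) / 2 - (k : ℝ)) : ℝ) : ℂ) *
      ∫ l in (0 : ℝ)..Real.pi,
        Complex.exp (-Complex.I * (gammaZero Q) * t * Real.cos l) *
          (Real.sin l : ℂ) * (Real.sin (((n : ℝ) + 2 * k + 1) * l) : ℂ)

/-- The sum of `g` over the sphere of radius `n` centred at `x`. -/
def sphereSum {Q : ℕ} (T : HomTree Q) (g : T.V → ℂ) (x : T.V) (n : ℕ) : ℂ :=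
  ∑' y : {y : T.V // T.graph.dist x y = n}, g y

/-- The Schrödinger propagator `e^{itℒ}`, realised (and extended to all
`L^p` spaces) as convolution with the radial kernel `s_t`:
`e^{itℒ}g(x) = ∑_{n≥0} s_t(n) ∑_{d(x,y)=n} g(y)`. -/
def propagate {Q : ℕ} (T : HomTree Q) (t : ℝ) (g : T.V → ℂ) (x : T.V) : ℂ :=
  ∑' n : ℕ, schKernel Q t n * sphereSum T g x n

/-- The `L^q(𝕋)` norm (with the counting measure), valued in `ℝ≥0∞`, for an
exponent `q : ℝ≥0∞`. -/
def spaceNorm {Q : ℕ} (T : HomTree Q) (q : ℝ≥0∞) (g : T.V → ℂ) : ℝ≥0∞ :=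
  if q = ∞ then ⨆ x : T.V, (‖g x‖₊ : ℝ≥0∞)
  else (∑' x : T.V, (‖g x‖₊ : ℝ≥0∞) ^ q.toReal) ^ (1 / q.toReal)

theorem integral_oscillatory_by_parts (a : ℝ) {h h' : ℝ → ℝ}
    (hd : ∀ x, HasDerivAt h (h' x) x) (hc : Continuous h') (h0 : h 0 = 0)
    (hpi : h Real.pi = 0) :
    |a| * ‖∫ l in (0 : ℝ)..Real.pi, Complex.exp (-Complex.I * a * Real.cos l) *
        (Real.sin l : ℂ) * (h l : ℂ)‖ =
      ‖∫ l in (0 : ℝ)..Real.pi, Complex.exp (-Complex.I * a * Real.cos l) * (h' l : ℂ)‖ := by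
  have hcont : Continuous h := continuous_iff_continuousAt.2 fun x => (hd x).continuousAt
  have key : ∀ x : ℝ, HasDerivAt
      (fun l : ℝ => Complex.exp (-Complex.I * a * Real.cos l) * (h l : ℂ))
      (Complex.I * a * (Complex.exp (-Complex.I * a * Real.cos x) * (Real.sin x : ℂ) * (h x : ℂ))
        + Complex.exp (-Complex.I * a * Real.cos x) * (h' x : ℂ)) x := by
    intro x
    have h1 : HasDerivAt (fun l : ℝ => ((Real.cos l : ℝ) : ℂ)) ((-Real.sin x : ℝ) : ℂ) x :=
      (Real.hasDerivAt_cos x).ofReal_comp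
    have h2 := ((h1.const_mul (-Complex.I * (a : ℂ))).cexp).mul (hd x).ofReal_comp
    refine h2.congr_deriv ?_
    push_cast
    ring
  have i1 : IntervalIntegrable (fun x : ℝ => Complex.I * a *
      (Complex.exp (-Complex.I * a * Real.cos x) * (Real.sin x : ℂ) * (h x : ℂ)))
      volume 0 Real.pi := by
    apply Continuous.intervalIntegrable; fun_prop
  have i2 : IntervalIntegrable (fun x : ℝ =>
      Complex.exp (-Complex.I * a * Real.cos x) * (h' x : ℂ)) volume 0 Real.pi := by
    apply Continuous.intervalIntegrable; fun_prop
  have h3 := intervalIntegral.integral_eq_sub_of_hasDerivAt (fun x _ => key x) (i1.add i2)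
  rw [intervalIntegral.integral_add i1 i2, intervalIntegral.integral_const_mul] at h3
  simp only [h0, hpi, Complex.ofReal_zero, mul_zero, sub_zero] at h3
  have h4 := congrArg norm (eq_neg_of_add_eq_zero_left h3)
  rw [norm_neg, norm_mul] at h4
  rw [← h4]
  simp

theorem integral_inv_sin_sq_add_le {e : ℝ} (he : 0 < e) :
    ∫ l in (0 : ℝ)..Real.pi, 1 / (Real.sin l ^ 2 + e ^ 2) ≤ Real.pi ^ 2 / 2 / e := by
  have hpi := Real.pi_pos
  set c : ℝ := 2 / Real.pi / e with hcdef
  have hc : 0 < c := by positivity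
  have hlow : ∀ l ∈ Set.Icc (0 : ℝ) (Real.pi / 2),
      1 / (Real.sin l ^ 2 + e ^ 2) ≤ (1 / e ^ 2) * (1 + (c * l) ^ 2)⁻¹ := by
    intro l hl
    have h1 := Real.mul_le_sin hl.1 hl.2
    have h2 : 0 ≤ 2 / Real.pi * l := mul_nonneg (by positivity) hl.1
    rw [← one_div, one_div_mul_one_div]
    apply one_div_le_one_div_of_le (by positivity)
    have h3 : e ^ 2 * (1 + (c * l) ^ 2) = (2 / Real.pi * l) ^ 2 + e ^ 2 := by
      rw [hcdef]; field_simp; ring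
    rw [h3]
    gcongr
  have hg : ∀ l : ℝ, 0 ≤ (1 / e ^ 2) * (1 + (c * l) ^ 2)⁻¹ := fun l => by positivity
  have hle : ∀ l ∈ Set.Icc (0 : ℝ) Real.pi, 1 / (Real.sin l ^ 2 + e ^ 2) ≤
      (1 / e ^ 2) * (1 + (c * l) ^ 2)⁻¹ + (1 / e ^ 2) * (1 + (c * (Real.pi - l)) ^ 2)⁻¹ := by
    intro l hl
    rcases le_total l (Real.pi / 2) with h | h
    · exact (hlow l ⟨hl.1, h⟩).trans (le_add_of_nonneg_right (hg _))
    · have := hlow (Real.pi - l) ⟨by linarith [hl.2], by linarith⟩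
      rw [Real.sin_pi_sub] at this
      exact this.trans (le_add_of_nonneg_left (hg _))
  have hcg : Continuous fun l : ℝ => (1 / e ^ 2) * (1 + (c * l) ^ 2)⁻¹ := by
    have : ∀ l : ℝ, 1 + (c * l) ^ 2 ≠ 0 := fun l => by positivity
    fun_prop (disch := assumption)
  have hcf : Continuous fun l : ℝ => 1 / (Real.sin l ^ 2 + e ^ 2) := by
    have : ∀ l : ℝ, Real.sin l ^ 2 + e ^ 2 ≠ 0 := fun l => by positivity
    fun_prop (disch := assumption)
  have hcg' : Continuous fun l : ℝ => (1 / e ^ 2) * (1 + (c * (Real.pi - l)) ^ 2)⁻¹ :=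
    hcg.comp (continuous_const.sub continuous_id)
  have hint : ∫ l in (0 : ℝ)..Real.pi, (1 / e ^ 2) * (1 + (c * l) ^ 2)⁻¹ ≤
      Real.pi ^ 2 / 4 / e := by
    rw [intervalIntegral.integral_const_mul,
      intervalIntegral.integral_comp_mul_left (fun x => (1 + x ^ 2)⁻¹) hc.ne',
      integral_inv_one_add_sq, mul_zero, Real.arctan_zero, sub_zero, smul_eq_mul]
    have h5 : Real.pi ^ 2 / 4 / e = 1 / e ^ 2 * (c⁻¹ * (Real.pi / 2)) := by
      rw [hcdef]; field_simp; ring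
    rw [h5]
    gcongr
    exact (Real.arctan_lt_pi_div_two _).le
  have hsymm : ∫ l in (0 : ℝ)..Real.pi, (1 / e ^ 2) * (1 + (c * (Real.pi - l)) ^ 2)⁻¹ =
      ∫ l in (0 : ℝ)..Real.pi, (1 / e ^ 2) * (1 + (c * l) ^ 2)⁻¹ := by
    rw [intervalIntegral.integral_comp_sub_left
      (fun l => (1 / e ^ 2) * (1 + (c * l) ^ 2)⁻¹) Real.pi]
    simp
  calc _ ≤ _ := intervalIntegral.integral_mono_on hpi.le (hcf.intervalIntegrable _ _)
        ((hcg.add hcg').intervalIntegrable _ _) hle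
    _ = _ := intervalIntegral.integral_add (hcg.intervalIntegrable _ _)
        (hcg'.intervalIntegrable _ _)
    _ ≤ Real.pi ^ 2 / 4 / e + Real.pi ^ 2 / 4 / e := by rw [hsymm]; gcongr
    _ = _ := by ring

theorem norm_oscillatory_kernel (a l : ℝ) :
    ‖Complex.exp (-Complex.I * a * Real.cos l)‖ = 1 := by
  have : -Complex.I * a * Real.cos l = ((-(a * Real.cos l) : ℝ) : ℂ) * Complex.I := by
    push_cast; ring
  rw [this, Complex.norm_exp_ofReal_mul_I]

theorem norm_integral_oscillatory_mul_cos_le {a e : ℝ} (he : 0 < e) (hae : |a| * e ^ 2 = 1)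
    {m : ℝ} (hm : 0 ≤ m) :
    ‖∫ l in (0 : ℝ)..Real.pi, Complex.exp (-Complex.I * a * Real.cos l) *
      (Real.cos (m * l) : ℂ)‖ ≤ (m + 2) * (Real.pi ^ 2 / 2) * e := by
  have hD : ∀ l : ℝ, 0 < Real.sin l ^ 2 + e ^ 2 := fun l => by positivity
  have hD' : ∀ l : ℝ, Real.sin l ^ 2 + e ^ 2 ≠ 0 := fun l => (hD l).ne'
  set h : ℝ → ℝ := fun l => Real.cos (m * l) * Real.sin l / (Real.sin l ^ 2 + e ^ 2) with hh
  set h' : ℝ → ℝ := fun l => -m * Real.sin (m * l) * Real.sin l / (Real.sin l ^ 2 + e ^ 2) +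
    Real.cos (m * l) * Real.cos l * (e ^ 2 - Real.sin l ^ 2) / (Real.sin l ^ 2 + e ^ 2) ^ 2 with hh'
  have hd : ∀ x, HasDerivAt h (h' x) x := by
    intro x
    have h1 : HasDerivAt (fun l : ℝ => Real.cos (m * l)) (-Real.sin (m * x) * m) x := by
      simpa using ((hasDerivAt_id x).const_mul m).cos
    have h2 := (h1.mul (Real.hasDerivAt_sin x)).div
      (((Real.hasDerivAt_sin x).pow 2).add_const (e ^ 2)) (hD' x)
    refine h2.congr_deriv ?_
    simp only [hh', Pi.mul_apply, Pi.pow_apply]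
    have := hD' x
    field_simp
    ring
  have hc : Continuous h' := by
    have : ∀ l : ℝ, (Real.sin l ^ 2 + e ^ 2) ^ 2 ≠ 0 := fun l => pow_ne_zero _ (hD' l)
    simp only [hh']
    fun_prop (disch := assumption)
  have hcont : Continuous h := continuous_iff_continuousAt.2 fun x => (hd x).continuousAt
  have parts := integral_oscillatory_by_parts a hd hc (by simp [hh]) (by simp [hh])
  have hcf : Continuous fun l : ℝ => 1 / (Real.sin l ^ 2 + e ^ 2) := by
    fun_prop (disch := assumption)
  set J := ∫ l in (0 : ℝ)..Real.pi, 1 / (Real.sin l ^ 2 + e ^ 2) with hJ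
  have hJle : J ≤ Real.pi ^ 2 / 2 / e := integral_inv_sin_sq_add_le he
  have b1 : ‖∫ l in (0 : ℝ)..Real.pi,
      Complex.exp (-Complex.I * a * Real.cos l) * (h' l : ℂ)‖ ≤ (m + 1) * J := by
    rw [hJ, ← intervalIntegral.integral_const_mul]
    apply intervalIntegral.norm_integral_le_of_norm_le Real.pi_pos.le
    · refine Eventually.of_forall fun l _ => ?_
      rw [norm_mul, norm_oscillatory_kernel, one_mul, Complex.norm_real, Real.norm_eq_abs]
      have hDl := hD l
      calc |h' l| ≤ |-m * Real.sin (m * l) * Real.sin l / (Real.sin l ^ 2 + e ^ 2)| +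
            |Real.cos (m * l) * Real.cos l * (e ^ 2 - Real.sin l ^ 2) /
              (Real.sin l ^ 2 + e ^ 2) ^ 2| := abs_add_le _ _
        _ ≤ m / (Real.sin l ^ 2 + e ^ 2) + (Real.sin l ^ 2 + e ^ 2) /
              (Real.sin l ^ 2 + e ^ 2) ^ 2 := by
            rw [abs_div, abs_div, abs_of_pos hDl, abs_of_pos (pow_pos hDl 2), abs_mul, abs_mul,
              abs_mul, abs_mul, abs_neg, abs_of_nonneg hm]
            gcongr
            · calc m * |Real.sin (m * l)| * |Real.sin l| ≤ m * 1 * 1 := by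
                    gcongr
                    · exact Real.abs_sin_le_one _
                    · exact Real.abs_sin_le_one _
                _ = m := by ring
            · calc |Real.cos (m * l)| * |Real.cos l| * |e ^ 2 - Real.sin l ^ 2|
                  ≤ 1 * 1 * (Real.sin l ^ 2 + e ^ 2) := by
                    gcongr
                    · exact Real.abs_cos_le_one _
                    · exact Real.abs_cos_le_one _
                    · rw [abs_le]
                      constructor <;> nlinarith [sq_nonneg (Real.sin l), sq_nonneg e]
                _ = _ := by ring
        _ = (m + 1) * (1 / (Real.sin l ^ 2 + e ^ 2)) := by field_simp
    · exact (continuous_const.mul hcf).intervalIntegrable _ _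
  have b2 : ‖∫ l in (0 : ℝ)..Real.pi, Complex.exp (-Complex.I * a * Real.cos l) *
      ((Real.cos (m * l) * (e ^ 2 / (Real.sin l ^ 2 + e ^ 2)) : ℝ) : ℂ)‖ ≤ e ^ 2 * J := by
    rw [hJ, ← intervalIntegral.integral_const_mul]
    apply intervalIntegral.norm_integral_le_of_norm_le Real.pi_pos.le
    · refine Eventually.of_forall fun l _ => ?_
      have hDl := hD l
      rw [norm_mul, norm_oscillatory_kernel, one_mul, Complex.norm_real, Real.norm_eq_abs,
        abs_mul, abs_of_pos (by positivity : 0 < e ^ 2 / (Real.sin l ^ 2 + e ^ 2)),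
        mul_one_div]
      exact mul_le_of_le_one_left (by positivity) (Real.abs_cos_le_one _)
    · exact (continuous_const.mul hcf).intervalIntegrable _ _
  have split : ∫ l in (0 : ℝ)..Real.pi, Complex.exp (-Complex.I * a * Real.cos l) *
      (Real.cos (m * l) : ℂ) =
      (∫ l in (0 : ℝ)..Real.pi, Complex.exp (-Complex.I * a * Real.cos l) *
        (Real.sin l : ℂ) * (h l : ℂ)) +
      ∫ l in (0 : ℝ)..Real.pi, Complex.exp (-Complex.I * a * Real.cos l) *
        ((Real.cos (m * l) * (e ^ 2 / (Real.sin l ^ 2 + e ^ 2)) : ℝ) : ℂ) := by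
    rw [← intervalIntegral.integral_add]
    · congr 1
      ext l
      have h1 : Real.cos (m * l) = Real.sin l * h l +
          Real.cos (m * l) * (e ^ 2 / (Real.sin l ^ 2 + e ^ 2)) := by
        simp only [hh]
        have := hD' l
        field_simp
      rw [mul_assoc (Complex.exp _), ← Complex.ofReal_mul, ← mul_add, ← Complex.ofReal_add, ← h1]
    · apply Continuous.intervalIntegrable; fun_prop
    · apply Continuous.intervalIntegrable; fun_prop (disch := assumption)
  have b3 : ‖∫ l in (0 : ℝ)..Real.pi, Complex.exp (-Complex.I * a * Real.cos l) *
        (Real.sin l : ℂ) * (h l : ℂ)‖ ≤ e ^ 2 * ((m + 1) * J) := by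
    rw [← parts] at b1
    calc _ = e ^ 2 * (|a| * ‖∫ l in (0 : ℝ)..Real.pi,
          Complex.exp (-Complex.I * a * Real.cos l) * (Real.sin l : ℂ) * (h l : ℂ)‖) := by
            rw [← mul_assoc, mul_comm (e ^ 2), hae, one_mul]
      _ ≤ _ := by gcongr
  rw [split]
  calc _ ≤ _ := norm_add_le _ _
    _ ≤ e ^ 2 * ((m + 1) * J) + e ^ 2 * J := add_le_add b3 b2
    _ = (m + 2) * e ^ 2 * J := by ring
    _ ≤ (m + 2) * e ^ 2 * (Real.pi ^ 2 / 2 / e) := by gcongr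
    _ = _ := by field_simp

theorem norm_integral_oscillatory_le_rpow {a : ℝ} (ha : a ≠ 0) (m : ℕ) :
    ‖∫ l in (0 : ℝ)..Real.pi, Complex.exp (-Complex.I * a * Real.cos l) *
      (Real.sin l : ℂ) * (Real.sin (m * l) : ℂ)‖ ≤
      Real.pi ^ 2 / 2 * (m + 1) ^ 2 * |a| ^ (-(3 / 2) : ℝ) := by
  have ha' : 0 < |a| := abs_pos.2 ha
  set e : ℝ := |a| ^ (-(1 / 2) : ℝ) with he
  have hepos : 0 < e := Real.rpow_pos_of_pos ha' _
  have hae : |a| * e ^ 2 = 1 := by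
    rw [he, ← Real.rpow_natCast, ← Real.rpow_mul ha'.le]
    norm_num [Real.rpow_neg_one, ha'.ne']
  have h3 : |a| ^ (-(3 / 2) : ℝ) * |a| = e := by
    rw [he, ← Real.rpow_add_one ha'.ne']
    norm_num
  have h1 := norm_integral_oscillatory_mul_cos_le hepos hae (Nat.cast_nonneg m)
  have hd : ∀ x, HasDerivAt (fun l : ℝ => Real.sin (m * l)) (m * Real.cos (m * x)) x := by
    intro x
    simpa [mul_comm] using ((hasDerivAt_id x).const_mul (m : ℝ)).sin
  have parts := integral_oscillatory_by_parts a hd (by fun_prop) (by simp)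
    (Real.sin_nat_mul_pi m)
  have h2 : ∀ l : ℝ, Complex.exp (-Complex.I * a * Real.cos l) *
      ((m * Real.cos (m * l) : ℝ) : ℂ) = (m : ℂ) *
        (Complex.exp (-Complex.I * a * Real.cos l) * (Real.cos (m * l) : ℂ)) := by
    intro l; push_cast; ring
  simp_rw [h2] at parts
  rw [intervalIntegral.integral_const_mul, norm_mul, Complex.norm_natCast] at parts
  refine le_of_mul_le_mul_left ?_ ha'
  rw [parts]
  calc _ ≤ (m : ℝ) * ((m + 2) * (Real.pi ^ 2 / 2) * e) := by gcongr
    _ = Real.pi ^ 2 / 2 * (m * (m + 2)) * e := by ring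
    _ ≤ Real.pi ^ 2 / 2 * (m + 1) ^ 2 * e := by gcongr; nlinarith
    _ = _ := by rw [← h3]; ring

theorem norm_integral_oscillatory_le (a : ℝ) (m : ℕ) :
    ‖∫ l in (0 : ℝ)..Real.pi, Complex.exp (-Complex.I * a * Real.cos l) *
      (Real.sin l : ℂ) * (Real.sin (m * l) : ℂ)‖ ≤ Real.pi ^ 2 / 2 * (m + 1) ^ 2 := by
  have h1 := intervalIntegral.norm_integral_le_of_norm_le_const (a := 0) (b := Real.pi) (C := 1)
    (f := fun l : ℝ => Complex.exp (-Complex.I * a * Real.cos l) *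
      (Real.sin l : ℂ) * (Real.sin (m * l) : ℂ)) (fun l _ => by
      rw [norm_mul, norm_mul, norm_oscillatory_kernel, one_mul, Complex.norm_real,
        Complex.norm_real]
      exact mul_le_one₀ (Real.abs_sin_le_one _) (norm_nonneg _) (Real.abs_sin_le_one _))
  rw [sub_zero, abs_of_pos Real.pi_pos, one_mul] at h1
  have h2 : (1 : ℝ) ≤ ((m : ℝ) + 1) ^ 2 := by nlinarith [(Nat.cast_nonneg m : (0 : ℝ) ≤ m)]
  calc _ ≤ Real.pi := h1
    _ ≤ Real.pi ^ 2 / 2 * 1 := by nlinarith [Real.pi_gt_three]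
    _ ≤ _ := by gcongr

theorem norm_schKernel_le_of_integral_le {Q : ℕ} (hQ : 2 ≤ Q) {M : ℝ} (hM : 0 ≤ M) :
    ∃ B : ℝ, 0 ≤ B ∧ ∀ (τ t : ℝ), 0 ≤ τ → (∀ m : ℕ, ‖∫ l in (0 : ℝ)..Real.pi,
        Complex.exp (-Complex.I * (gammaZero Q) * t * Real.cos l) *
          (Real.sin l : ℂ) * (Real.sin (m * l) : ℂ)‖ ≤ M * (m + 1) ^ 2 * τ) →
      ∀ n : ℕ, ‖schKernel Q t n‖ ≤ B * τ * (n + 1) ^ 2 * (Real.sqrt Q)⁻¹ ^ n := by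
  have hQ0 : (0 : ℝ) < Q := by positivity
  have hsum : Summable fun k : ℕ => ((k : ℝ) + 1) ^ 2 * ((Q : ℝ)⁻¹) ^ k := by
    have hr : ‖((Q : ℝ)⁻¹)‖ < 1 := by
      rw [norm_inv, Real.norm_of_nonneg hQ0.le]
      exact inv_lt_one_of_one_lt₀ (by exact_mod_cast hQ)
    have h := fun j => summable_pow_mul_geometric_of_norm_lt_one j hr
    refine (((h 2).add ((h 1).mul_left 2)).add (h 0)).congr fun k => ?_
    ring
  obtain ⟨S, hS⟩ := hsum
  have hS0 : 0 ≤ S := hS.nonneg fun k => by positivity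
  refine ⟨2 / Real.pi * (4 * M * S), by positivity, fun τ t hτ hI n => ?_⟩
  have hpow : ∀ k : ℕ, (Q : ℝ) ^ (-(n : ℝ) / 2 - (k : ℝ)) =
      (Real.sqrt Q)⁻¹ ^ n * ((Q : ℝ)⁻¹) ^ k := by
    intro k
    rw [Real.rpow_sub hQ0, Real.rpow_natCast, inv_pow, inv_pow, Real.sqrt_eq_rpow,
      ← Real.rpow_natCast ((Q : ℝ) ^ (1 / 2 : ℝ)), ← Real.rpow_mul hQ0.le,
      ← Real.rpow_neg hQ0.le, div_eq_mul_inv]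
    congr 2
    ring
  have hb := tsum_of_norm_bounded (hS.mul_left (4 * M * τ * (n + 1) ^ 2 * (Real.sqrt Q)⁻¹ ^ n))
    (f := fun k : ℕ => (((Q : ℝ) ^ (-(n : ℝ) / 2 - (k : ℝ)) : ℝ) : ℂ) *
      ∫ l in (0 : ℝ)..Real.pi,
        Complex.exp (-Complex.I * (gammaZero Q) * t * Real.cos l) *
          (Real.sin l : ℂ) * (Real.sin (((n : ℝ) + 2 * k + 1) * l) : ℂ)) (fun k => by
      have hk := hI (n + 2 * k + 1)
      simp only [Nat.cast_add, Nat.cast_mul, Nat.cast_one, Nat.cast_ofNat] at hk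
      rw [norm_mul, Complex.norm_real, Real.norm_of_nonneg (Real.rpow_nonneg hQ0.le _), hpow]
      have h4 : ((n : ℝ) + 2 * k + 1 + 1) ^ 2 ≤ 4 * (n + 1) ^ 2 * (k + 1) ^ 2 := by
        have h5 : (n : ℝ) + 2 * k + 1 + 1 ≤ 2 * (n + 1) * (k + 1) := by
          nlinarith [mul_nonneg (Nat.cast_nonneg (α := ℝ) n) (Nat.cast_nonneg (α := ℝ) k),
            Nat.cast_nonneg (α := ℝ) n, Nat.cast_nonneg (α := ℝ) k]
        calc _ ≤ (2 * ((n : ℝ) + 1) * (k + 1)) ^ 2 := by gcongr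
          _ = _ := by ring
      calc _ ≤ ((Real.sqrt Q)⁻¹ ^ n * ((Q : ℝ)⁻¹) ^ k) *
            (M * (4 * (n + 1) ^ 2 * (k + 1) ^ 2) * τ) := by
              refine mul_le_mul_of_nonneg_left ?_ (by positivity)
              exact hk.trans (by gcongr)
        _ = _ := by ring)
  rw [schKernel, norm_mul, norm_mul]
  have h6 : ‖Complex.exp (Complex.I * t)‖ = 1 := by
    rw [mul_comm, Complex.norm_exp_ofReal_mul_I]
  have h7 : ‖(2 / Real.pi : ℂ)‖ = 2 / Real.pi := by
    rw [norm_div, Complex.norm_real, Real.norm_of_nonneg Real.pi_pos.le]; norm_num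
  rw [h6, h7, one_mul]
  calc _ ≤ 2 / Real.pi * (4 * M * τ * (n + 1) ^ 2 * (Real.sqrt Q)⁻¹ ^ n * S) := by
        gcongr
    _ = _ := by ring

theorem norm_schKernel_le {Q : ℕ} (hQ : 2 ≤ Q) :
    ∃ B : ℝ, 0 ≤ B ∧ ∀ (t : ℝ) (n : ℕ),
      ‖schKernel Q t n‖ ≤ B * (n + 1) ^ 2 * (Real.sqrt Q)⁻¹ ^ n ∧
      (t ≠ 0 → ‖schKernel Q t n‖ ≤
        B * |t| ^ (-(3 / 2) : ℝ) * (n + 1) ^ 2 * (Real.sqrt Q)⁻¹ ^ n) := by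
  have hs : 0 < Real.sqrt Q := Real.sqrt_pos.2 (by positivity)
  have hg : 0 < gammaZero Q := by rw [gammaZero]; positivity
  set c : ℝ := (gammaZero Q) ^ (-(3 / 2) : ℝ) with hc
  have hc0 : 0 < c := Real.rpow_pos_of_pos hg _
  obtain ⟨B, hB, h⟩ := norm_schKernel_le_of_integral_le hQ
    (M := Real.pi ^ 2 / 2) (by positivity)
  have hcast : ∀ t : ℝ, -Complex.I * (gammaZero Q) * t =
      -Complex.I * ((gammaZero Q * t : ℝ) : ℂ) := fun t => by push_cast; ring
  refine ⟨B * (1 + c), by positivity, fun t n => ⟨?_, fun ht => ?_⟩⟩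
  · have h1 := h 1 t zero_le_one (fun m => by
      rw [hcast, mul_one]; exact norm_integral_oscillatory_le _ m) n
    refine h1.trans ?_
    gcongr
    linarith
  · have h1 := h (c * |t| ^ (-(3 / 2) : ℝ)) t (by positivity) (fun m => by
      rw [hcast, hc, ← Real.mul_rpow hg.le (abs_nonneg t)]
      have := norm_integral_oscillatory_le_rpow (mul_ne_zero hg.ne' ht) m
      rwa [abs_mul, abs_of_pos hg] at this) n
    refine h1.trans ?_
    rw [← mul_assoc B]
    gcongr
    linarith

theorem SimpleGraph.IsTree.eq_of_adj_of_dist_add_one_eq {V : Type*} {G : SimpleGraph V}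
    (hG : G.IsTree) {o v w w' : V} (hw : G.Adj v w) (hw' : G.Adj v w')
    (h : G.dist o w + 1 = G.dist o v) (h' : G.dist o w' + 1 = G.dist o v) : w = w' := by
  have key : ∀ u, G.Adj v u → G.dist o u + 1 = G.dist o v →
      ∃ p : G.Walk o v, p.IsPath ∧ u ∈ p.support := by
    intro u hu hd
    obtain ⟨p, -, hp⟩ := hG.connected.exists_path_of_dist o u
    exact ⟨p.concat hu.symm,
      SimpleGraph.Walk.isPath_of_length_eq_dist _ (by rw [SimpleGraph.Walk.length_concat, hp, hd]),
      p.support_subset_support_concat _ p.end_mem_support⟩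
  obtain ⟨p, hp, hwp⟩ := key w hw h
  obtain ⟨p', hp', hwp'⟩ := key w' hw' h'
  obtain rfl := (hG.existsUnique_path o v).unique hp hp'
  rw [hG.isAcyclic.eq_penultimate_of_adj_end hp hw hwp,
    hG.isAcyclic.eq_penultimate_of_adj_end hp hw' hwp']

theorem SimpleGraph.Connected.exists_adj_dist_eq {V : Type*} {G : SimpleGraph V}
    (hG : G.Connected) {y z : V} {n : ℕ} (h : G.dist y z = n + 1) :
    ∃ y', G.Adj y y' ∧ G.dist y' z = n := by
  obtain ⟨p, hp⟩ := hG.exists_walk_length_eq_dist y z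
  rw [h] at hp
  cases p with
  | nil => simp at hp
  | @cons _ y' _ hadj p' =>
    rw [SimpleGraph.Walk.length_cons] at hp
    have h1 := SimpleGraph.dist_le p'
    have h2 := hG.dist_triangle (u := y) (v := y') (w := z)
    rw [SimpleGraph.dist_eq_one_iff_adj.2 hadj] at h2
    exact ⟨y', hadj, by omega⟩

section TreeWeight

open scoped Classical

variable {Q : ℕ} (T : HomTree Q)

/-- The neighbours of a vertex. -/
def HomTree.nbrs (x : T.V) : Finset T.V :=
  (Set.finite_of_ncard_ne_zero (s := {y : T.V | T.graph.Adj x y})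
    (by rw [T.regular x]; omega)).toFinset

theorem HomTree.mem_nbrs {x y : T.V} : y ∈ T.nbrs x ↔ T.graph.Adj x y := by
  simp [HomTree.nbrs]

theorem HomTree.card_nbrs (x : T.V) : (T.nbrs x).card = Q + 1 := by
  rw [← T.regular x, HomTree.nbrs,
    Set.ncard_eq_toFinset_card _ (Set.finite_of_ncard_ne_zero (by rw [T.regular x]; omega))]

/-- `√Q` as an extended nonnegative real. -/
def sqrtENN (Q : ℕ) : ℝ≥0∞ := ENNReal.ofReal (Real.sqrt Q)

theorem sqrtENN_ne_zero (hQ : 2 ≤ Q) : sqrtENN Q ≠ 0 := by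
  rw [sqrtENN, Ne, ENNReal.ofReal_eq_zero, not_le]
  exact Real.sqrt_pos.2 (by positivity)

theorem sqrtENN_ne_top : sqrtENN Q ≠ ∞ := ENNReal.ofReal_ne_top

theorem sqrtENN_mul_self : sqrtENN Q * sqrtENN Q = Q := by
  rw [sqrtENN, ← ENNReal.ofReal_mul (Real.sqrt_nonneg _), Real.mul_self_sqrt (by positivity)]
  simp

/-- The weight `Q^{-|x|/2}` attached to a root `o`. -/
def HomTree.weight (o x : T.V) : ℝ≥0∞ := (sqrtENN Q)⁻¹ ^ T.graph.dist o x

theorem HomTree.weight_ne_zero (o x : T.V) : T.weight o x ≠ 0 :=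
  pow_ne_zero _ (ENNReal.inv_ne_zero.2 sqrtENN_ne_top)

theorem HomTree.weight_ne_top (hQ : 2 ≤ Q) (o x : T.V) : T.weight o x ≠ ∞ :=
  ENNReal.pow_ne_top (ENNReal.inv_ne_top.2 (sqrtENN_ne_zero hQ))

theorem HomTree.weight_of_dist_eq_add_one {o x y : T.V}
    (h : T.graph.dist o y = T.graph.dist o x + 1) :
    T.weight o y = (sqrtENN Q)⁻¹ * T.weight o x := by
  rw [HomTree.weight, HomTree.weight, h, pow_succ']

theorem HomTree.weight_of_add_one_eq_dist (hQ : 2 ≤ Q) {o x y : T.V}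
    (h : T.graph.dist o y + 1 = T.graph.dist o x) :
    T.weight o y = sqrtENN Q * T.weight o x := by
  rw [T.weight_of_dist_eq_add_one h.symm, ← mul_assoc,
    ENNReal.mul_inv_cancel (sqrtENN_ne_zero hQ) sqrtENN_ne_top, one_mul]

/-- The sum of the weight over the points at distance `n` from `y` lying behind `y`
as seen from `x`. -/
def HomTree.branchSum (o : T.V) (n : ℕ) (x y : T.V) : ℝ≥0∞ :=
  ∑' z : T.V, if T.graph.dist x z = n + 1 ∧ T.graph.dist y z = n then T.weight o z else 0

theorem HomTree.branchSum_zero_le (o x y : T.V) : T.branchSum o 0 x y ≤ T.weight o y := by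
  rw [HomTree.branchSum, ← tsum_ite_eq y (fun z => T.weight o z)]
  refine ENNReal.tsum_le_tsum fun z => ?_
  by_cases h : T.graph.dist y z = 0
  · rw [T.isTree.connected.dist_eq_zero_iff] at h
    subst h
    rw [if_pos rfl]
    split_ifs <;> simp
  · simp [h]

theorem HomTree.branchSum_succ_le (o : T.V) (n : ℕ) (x y : T.V) :
    T.branchSum o (n + 1) x y ≤ ∑ y' ∈ (T.nbrs y).erase x, T.branchSum o n y y' := by
  simp only [HomTree.branchSum]
  rw [← Summable.tsum_finsetSum fun _ _ => ENNReal.summable]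
  refine ENNReal.tsum_le_tsum fun z => ?_
  split_ifs with h
  · obtain ⟨y', hadj, hd⟩ := T.isTree.connected.exists_adj_dist_eq h.2
    have hne : y' ≠ x := by rintro rfl; omega
    refine le_trans ?_ (Finset.single_le_sum (fun _ _ => zero_le)
      (Finset.mem_erase.2 ⟨hne, T.mem_nbrs.2 hadj⟩))
    rw [if_pos ⟨h.2, hd⟩]
  · exact zero_le

theorem HomTree.tsum_sphere_succ_le (o x : T.V) (n : ℕ) :
    (∑' z : T.V, if T.graph.dist x z = n + 1 then T.weight o z else 0) ≤
      ∑ y ∈ T.nbrs x, T.branchSum o n x y := by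
  simp only [HomTree.branchSum]
  rw [← Summable.tsum_finsetSum fun _ _ => ENNReal.summable]
  refine ENNReal.tsum_le_tsum fun z => ?_
  split_ifs with h
  · obtain ⟨y, hadj, hd⟩ := T.isTree.connected.exists_adj_dist_eq h
    refine le_trans ?_ (Finset.single_le_sum (fun _ _ => zero_le) (T.mem_nbrs.2 hadj))
    rw [if_pos ⟨h, hd⟩]
  · exact zero_le

theorem HomTree.sum_branchSum_le (hQ : 2 ≤ Q) (o : T.V) (n : ℕ)
    (hdown : ∀ x y, T.graph.Adj x y → T.graph.dist o y = T.graph.dist o x + 1 →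
      T.branchSum o n x y ≤ sqrtENN Q ^ n * T.weight o y)
    (hany : ∀ x y, T.graph.Adj x y →
      T.branchSum o n x y ≤ (n + 1) * sqrtENN Q ^ n * T.weight o y)
    (y : T.V) (s : Finset T.V) (hs : s ⊆ T.nbrs y) :
    ∑ y' ∈ s, T.branchSum o n y y' ≤
      s.card * ((sqrtENN Q)⁻¹ * sqrtENN Q ^ n * T.weight o y) +
        (n + 1) * sqrtENN Q ^ (n + 1) * T.weight o y := by
  set P : T.V → Prop := fun y' => T.graph.dist o y' + 1 = T.graph.dist o y with hP
  have hterm : ∀ y' ∈ s, T.branchSum o n y y' ≤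
      (sqrtENN Q)⁻¹ * sqrtENN Q ^ n * T.weight o y +
        if P y' then (n + 1) * sqrtENN Q ^ (n + 1) * T.weight o y else 0 := by
    intro y' hy'
    have hadj := T.mem_nbrs.1 (hs hy')
    rcases T.isTree.dist_eq_dist_add_one_of_adj o hadj with h | h
    · rw [if_pos (show P y' from h.symm)]
      refine le_trans (hany y y' hadj) (le_trans (le_of_eq ?_) le_add_self)
      rw [T.weight_of_add_one_eq_dist hQ h.symm, pow_succ]
      ring
    · refine le_trans (hdown y y' hadj h) (le_trans (le_of_eq ?_) le_self_add)
      rw [T.weight_of_dist_eq_add_one h]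
      ring
  refine (Finset.sum_le_sum hterm).trans ?_
  rw [Finset.sum_add_distrib, Finset.sum_const, nsmul_eq_mul, ← Finset.sum_filter,
    Finset.sum_const, nsmul_eq_mul]
  have hcard : (s.filter P).card ≤ 1 := by
    refine Finset.card_le_one.2 fun a ha b hb => ?_
    rw [Finset.mem_filter] at ha hb
    exact T.isTree.eq_of_adj_of_dist_add_one_eq (T.mem_nbrs.1 (hs ha.1))
      (T.mem_nbrs.1 (hs hb.1)) ha.2 hb.2
  exact add_le_add le_rfl (mul_le_of_le_one_left zero_le (by exact_mod_cast hcard))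

theorem natCast_mul_inv_sqrtENN (hQ : 2 ≤ Q) (n : ℕ) :
    (Q : ℝ≥0∞) * ((sqrtENN Q)⁻¹ * sqrtENN Q ^ n) = sqrtENN Q ^ (n + 1) := by
  rw [← sqrtENN_mul_self, ← mul_assoc, mul_assoc (sqrtENN Q),
    ENNReal.mul_inv_cancel (sqrtENN_ne_zero hQ) sqrtENN_ne_top, mul_one, pow_succ']

theorem HomTree.branchSum_le (hQ : 2 ≤ Q) (o : T.V) (n : ℕ) :
    (∀ x y, T.graph.Adj x y → T.graph.dist o y = T.graph.dist o x + 1 →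
      T.branchSum o n x y ≤ sqrtENN Q ^ n * T.weight o y) ∧
    (∀ x y, T.graph.Adj x y →
      T.branchSum o n x y ≤ (n + 1) * sqrtENN Q ^ n * T.weight o y) := by
  induction n with
  | zero =>
    exact ⟨fun x y _ _ => by simpa using T.branchSum_zero_le o x y,
      fun x y _ => by simpa using T.branchSum_zero_le o x y⟩
  | succ n ih =>
    have hcard : ∀ {x y}, T.graph.Adj x y → ((T.nbrs y).erase x).card = Q := fun {x y} h => by
      rw [Finset.card_erase_of_mem (T.mem_nbrs.2 h.symm), T.card_nbrs, Nat.add_sub_cancel]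
    refine ⟨fun x y hxy h => ?_, fun x y hxy => ?_⟩
    · refine (T.branchSum_succ_le o n x y).trans ?_
      have hterm : ∀ y' ∈ (T.nbrs y).erase x, T.branchSum o n y y' ≤
          (sqrtENN Q)⁻¹ * sqrtENN Q ^ n * T.weight o y := by
        intro y' hy'
        rw [Finset.mem_erase, T.mem_nbrs] at hy'
        rcases T.isTree.dist_eq_dist_add_one_of_adj o hy'.2 with h' | h'
        · exact absurd (T.isTree.eq_of_adj_of_dist_add_one_eq hy'.2 hxy.symm h'.symm h.symm) hy'.1
        · refine (ih.1 y y' hy'.2 h').trans (le_of_eq ?_)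
          rw [T.weight_of_dist_eq_add_one h']
          ring
      refine (Finset.sum_le_sum hterm).trans (le_of_eq ?_)
      rw [Finset.sum_const, hcard hxy, nsmul_eq_mul, ← mul_assoc, natCast_mul_inv_sqrtENN hQ]
    · refine (T.branchSum_succ_le o n x y).trans ?_
      refine (T.sum_branchSum_le hQ o n ih.1 ih.2 y _ (Finset.erase_subset _ _)).trans
        (le_of_eq ?_)
      rw [hcard hxy, ← mul_assoc, natCast_mul_inv_sqrtENN hQ]
      push_cast
      ring

theorem HomTree.tsum_sphere_weight_le (hQ : 2 ≤ Q) (o x : T.V) (n : ℕ) :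
    (∑' z : T.V, if T.graph.dist x z = n then T.weight o z else 0) ≤
      (n + 2) * sqrtENN Q ^ n * T.weight o x := by
  cases n with
  | zero =>
    have h : ∀ z, (if T.graph.dist x z = 0 then T.weight o z else 0) =
        if z = x then T.weight o z else 0 := fun z => by
      simp only [T.isTree.connected.dist_eq_zero_iff, eq_comm]
    simp_rw [h]
    rw [tsum_ite_eq]
    simp only [Nat.cast_zero, zero_add, pow_zero, mul_one]
    exact le_mul_of_one_le_left (zero_le) one_le_two
  | succ n =>
    refine (T.tsum_sphere_succ_le o x n).trans ?_
    refine (T.sum_branchSum_le hQ o n (T.branchSum_le hQ o n).1 (T.branchSum_le hQ o n).2 x _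
      subset_rfl).trans ?_
    rw [T.card_nbrs]
    calc _ ≤ ((2 * Q : ℕ) : ℝ≥0∞) * ((sqrtENN Q)⁻¹ * sqrtENN Q ^ n * T.weight o x) +
          (n + 1) * sqrtENN Q ^ (n + 1) * T.weight o x := by gcongr; omega
      _ = 2 * (Q * ((sqrtENN Q)⁻¹ * sqrtENN Q ^ n)) * T.weight o x +
          (n + 1) * sqrtENN Q ^ (n + 1) * T.weight o x := by push_cast; ring
      _ = _ := by rw [natCast_mul_inv_sqrtENN hQ]; push_cast; ring

theorem HomTree.tsum_radial_eq (k : ℕ → ℝ≥0∞) (g : T.V → ℝ≥0∞) (x : T.V) :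
    ∑' y, k (T.graph.dist x y) * g y =
      ∑' n : ℕ, k n * ∑' y, if T.graph.dist x y = n then g y else 0 := by
  simp_rw [← ENNReal.tsum_mul_left]
  rw [ENNReal.tsum_comm]
  refine tsum_congr fun y => ?_
  rw [← tsum_ite_eq (T.graph.dist x y) (fun n => k n * g y)]
  refine tsum_congr fun n => ?_
  by_cases h : n = T.graph.dist x y
  · simp [h]
  · simp [h, Ne.symm h]

theorem HomTree.tsum_radial_weight_le (hQ : 2 ≤ Q) (k : ℕ → ℝ≥0∞) (o x : T.V) :
    ∑' y, k (T.graph.dist x y) * T.weight o y ≤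
      (∑' n : ℕ, k n * ((n + 2) * sqrtENN Q ^ n)) * T.weight o x := by
  rw [T.tsum_radial_eq, ← ENNReal.tsum_mul_right]
  refine ENNReal.tsum_le_tsum fun n => ?_
  rw [mul_assoc]
  gcongr
  exact T.tsum_sphere_weight_le hQ o x n

theorem enorm_propagate_le (t : ℝ) (f : T.V → ℂ) (x : T.V) :
    ‖propagate T t f x‖ₑ ≤ ∑' y, ‖schKernel Q t (T.graph.dist x y)‖ₑ * ‖f y‖ₑ := by
  rw [T.tsum_radial_eq (fun n => ‖schKernel Q t n‖ₑ)]
  refine enorm_tsum_le_tsum_enorm.trans (ENNReal.tsum_le_tsum fun n => ?_)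
  rw [enorm_mul]
  gcongr
  refine enorm_tsum_le_tsum_enorm.trans (le_of_eq ?_)
  refine (tsum_subtype {y | T.graph.dist x y = n} fun y => ‖f y‖ₑ).trans ?_
  simp [Set.indicator_apply]

end TreeWeight

theorem tsum_mul_mul_rpow_le {V : Type*} {r : ℝ} (hr : 2 < r) (F G H : V → ℝ≥0∞) :
    (∑' y, F y ^ (1 / r) * G y ^ (1 / r) * H y ^ (1 - 2 / r)) ^ r ≤
      (∑' y, F y) * (∑' y, G y) * (∑' y, H y) ^ (r - 2) := by
  let _ : MeasurableSpace V := ⊤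
  have hr0 : 0 < r := by linarith
  have h2 : 0 ≤ 1 - 2 / r := by
    rw [sub_nonneg, div_le_one hr0]; exact hr.le
  have h := ENNReal.lintegral_prod_norm_pow_le (μ := Measure.count) (Finset.univ : Finset (Fin 3))
    (f := ![F, G, H]) (p := ![1 / r, 1 / r, 1 - 2 / r])
    (fun i _ => (measurable_from_top).aemeasurable)
    (by simp [Fin.sum_univ_three]; ring)
    (fun i _ => by fin_cases i <;> simp [hr0.le]; simpa using h2)
  simp only [Fin.prod_univ_three, lintegral_count] at h
  simp only [Matrix.cons_val_zero, Matrix.cons_val_one, Matrix.cons_val] at h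
  refine (ENNReal.rpow_le_rpow h hr0.le).trans (le_of_eq ?_)
  rw [ENNReal.mul_rpow_of_nonneg _ _ hr0.le, ENNReal.mul_rpow_of_nonneg _ _ hr0.le,
    ← ENNReal.rpow_mul, ← ENNReal.rpow_mul, ← ENNReal.rpow_mul, one_div_mul_cancel hr0.ne',
    ENNReal.rpow_one, ENNReal.rpow_one]
  congr 2
  field_simp

theorem tsum_schur_rpow_le {V : Type*} {r p : ℝ} (hr : 2 < r) (hp : p = r / (r - 1))
    {K : V → V → ℝ≥0∞} (hK : ∀ x y, K x y = K y x) {w : V → ℝ≥0∞} (hw0 : ∀ x, w x ≠ 0)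
    (hwt : ∀ x, w x ≠ ∞) {A : ℝ≥0∞}
    (hA : ∀ x, ∑' y, K x y ^ (r / 2) * w y ≤ A * w x) (f : V → ℝ≥0∞) :
    ∑' x, (∑' y, K x y * f y) ^ r ≤ A ^ (2 : ℝ) * (∑' y, f y ^ p) ^ (r - 1) := by
  have hr0 : 0 < r := by linarith
  have hr1 : 0 < r - 1 := by linarith
  have hp0 : 0 < p := by rw [hp]; positivity
  have h2 : 0 ≤ 1 - 2 / r := by
    rw [sub_nonneg, div_le_one hr0]; exact hr.le
  set Φ := ∑' y, f y ^ p with hΦ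
  have hpt : ∀ x, (∑' y, K x y * f y) ^ r ≤
      (∑' y, K x y ^ (r / 2) * (f y ^ p * (w y)⁻¹)) * (A * w x) * Φ ^ (r - 2) := by
    intro x
    have h := tsum_mul_mul_rpow_le hr (fun y => K x y ^ (r / 2) * (f y ^ p * (w y)⁻¹))
      (fun y => K x y ^ (r / 2) * w y) (fun y => f y ^ p)
    refine le_trans (le_of_eq ?_) (h.trans ?_)
    · congr 1
      refine tsum_congr fun y => ?_
      have hi : 0 ≤ 1 / r := by positivity
      rw [← ENNReal.mul_rpow_of_nonneg _ _ hi]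
      have h3 : K x y ^ (r / 2) * (f y ^ p * (w y)⁻¹) * (K x y ^ (r / 2) * w y) =
          K x y ^ r * f y ^ p := by
        calc _ = (K x y ^ (r / 2) * K x y ^ (r / 2)) * f y ^ p * ((w y)⁻¹ * w y) := by ring
          _ = _ := by
            rw [ENNReal.inv_mul_cancel (hw0 y) (hwt y), mul_one,
              ← ENNReal.rpow_add_of_nonneg _ _ (by positivity) (by positivity), add_halves]
      rw [h3, ENNReal.mul_rpow_of_nonneg _ _ hi, ← ENNReal.rpow_mul, mul_one_div_cancel hr0.ne',
        ENNReal.rpow_one, mul_assoc, ← ENNReal.rpow_mul, ← ENNReal.rpow_mul,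
        ← ENNReal.rpow_add_of_nonneg _ _ (by positivity) (mul_nonneg hp0.le h2)]
      have h4 : p * (1 / r) + p * (1 - 2 / r) = 1 := by
        rw [hp]; field_simp; ring
      rw [h4, ENNReal.rpow_one]
    · gcongr
      exact hA x
  calc _ ≤ _ := ENNReal.tsum_le_tsum hpt
    _ = A * Φ ^ (r - 2) *
        ∑' y, f y ^ p * (w y)⁻¹ * ∑' x, K y x ^ (r / 2) * w x := by
      rw [← ENNReal.tsum_mul_left]
      simp_rw [← ENNReal.tsum_mul_left, ← ENNReal.tsum_mul_right]
      rw [ENNReal.tsum_comm]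
      refine tsum_congr fun y => tsum_congr fun x => ?_
      rw [hK y x]
      ring
    _ ≤ A * Φ ^ (r - 2) * ∑' y, f y ^ p * (w y)⁻¹ * (A * w y) := by
      gcongr with y
      exact hA y
    _ = A * Φ ^ (r - 2) * (A * Φ) := by
      rw [hΦ, ← ENNReal.tsum_mul_left (a := A)]
      congr 1
      refine tsum_congr fun y => ?_
      calc _ = A * f y ^ p * ((w y)⁻¹ * w y) := by ring
        _ = _ := by rw [ENNReal.inv_mul_cancel (hw0 y) (hwt y), mul_one]
    _ = A ^ (2 : ℝ) * (Φ ^ (r - 2) * Φ ^ (1 : ℝ)) := by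
      rw [ENNReal.rpow_one, ENNReal.rpow_two]; ring
    _ = _ := by
      rw [← ENNReal.rpow_add_of_nonneg _ _ (by linarith) zero_le_one]
      congr 2
      ring

theorem tsum_rpow_rpow_inv_anti {V : Type*} {p q : ℝ} (hp : 0 < p) (hpq : p ≤ q)
    (f : V → ℝ≥0∞) :
    (∑' x, f x ^ q) ^ (1 / q) ≤ (∑' x, f x ^ p) ^ (1 / p) := by
  have hq : 0 < q := hp.trans_le hpq
  have hs : 0 ≤ q / p - 1 := by rw [sub_nonneg, one_le_div hp]; exact hpq
  set Φ := ∑' x, f x ^ p with hΦ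
  have h : ∑' x, f x ^ q ≤ Φ ^ (q / p) := by
    calc ∑' x, f x ^ q ≤ ∑' x, f x ^ p * Φ ^ (q / p - 1) := by
          refine ENNReal.tsum_le_tsum fun x => ?_
          have h1 : f x ^ q = f x ^ p * (f x ^ p) ^ (q / p - 1) := by
            rw [← ENNReal.rpow_mul, ← ENNReal.rpow_add_of_nonneg _ _ hp.le (by positivity)]
            congr 1
            field_simp
            ring
          rw [h1]
          gcongr
          exact ENNReal.le_tsum x
      _ = Φ ^ (1 : ℝ) * Φ ^ (q / p - 1) := by rw [ENNReal.tsum_mul_right, ENNReal.rpow_one]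
      _ = _ := by
          rw [← ENNReal.rpow_add_of_nonneg _ _ zero_le_one hs]
          congr 1
          ring
  calc _ ≤ (Φ ^ (q / p)) ^ (1 / q) := ENNReal.rpow_le_rpow h (by positivity)
    _ = _ := by
      rw [← ENNReal.rpow_mul]
      congr 1
      field_simp

theorem tsum_kernel_majorant_ne_top {Q : ℕ} (hQ : 2 ≤ Q) {B r : ℝ} (hB : 0 ≤ B) (hr : 2 < r) :
    ∑' n : ℕ, ENNReal.ofReal (B * (n + 1) ^ 2 * (Real.sqrt Q)⁻¹ ^ n) ^ (r / 2) *
      ((n + 2) * sqrtENN Q ^ n) ≠ ∞ := by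
  have hs1 : 1 < Real.sqrt Q := by
    rw [Real.lt_sqrt zero_le_one]; norm_num; omega
  have hs : 0 < Real.sqrt Q := by linarith
  set ρ : ℝ := Real.sqrt Q ^ (1 - r / 2) with hρ
  have hρ0 : 0 < ρ := Real.rpow_pos_of_pos hs _
  have hρ1 : ρ < 1 := Real.rpow_lt_one_of_one_lt_of_neg hs1 (by linarith)
  set N := ⌈r⌉₊ with hN
  have hgeom : Summable fun n : ℕ => (n : ℝ) ^ (N + 1) * ρ ^ n :=
    summable_pow_mul_geometric_of_norm_lt_one (N + 1) (by rwa [Real.norm_of_nonneg hρ0.le])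
  have hsum : Summable fun n : ℕ => 2 * B ^ (r / 2) * ρ⁻¹ *
      (((n + 1 : ℕ) : ℝ) ^ (N + 1) * ρ ^ (n + 1)) :=
    ((summable_nat_add_iff (f := fun n : ℕ => (n : ℝ) ^ (N + 1) * ρ ^ n) 1).2 hgeom).mul_left _
  have htop := hsum.tsum_ofReal_ne_top
  refine ne_top_of_le_ne_top htop (ENNReal.tsum_le_tsum fun n => ?_)
  have hcast : ((n : ℝ≥0∞) + 2) * sqrtENN Q ^ n =
      ENNReal.ofReal (((n : ℝ) + 2) * Real.sqrt Q ^ n) := by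
    rw [ENNReal.ofReal_mul (by positivity), ENNReal.ofReal_add (by positivity) (by positivity),
      ENNReal.ofReal_pow hs.le, sqrtENN]
    simp
  rw [hcast, ENNReal.ofReal_rpow_of_nonneg (by positivity) (by linarith),
    ← ENNReal.ofReal_mul (by positivity)]
  refine ENNReal.ofReal_le_ofReal ?_
  have hn1 : (1 : ℝ) ≤ n + 1 := by linarith [Nat.cast_nonneg (α := ℝ) n]
  rw [Real.mul_rpow (by positivity) (by positivity), Real.mul_rpow hB (by positivity)]
  have e1 : (((n : ℝ) + 1) ^ 2) ^ (r / 2) ≤ ((n : ℝ) + 1) ^ N := by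
    rw [← Real.rpow_natCast, ← Real.rpow_natCast, ← Real.rpow_mul (by positivity)]
    refine Real.rpow_le_rpow_of_exponent_le hn1 ?_
    have := Nat.le_ceil r
    push_cast
    linarith
  have e2 : ((Real.sqrt Q)⁻¹ ^ n) ^ (r / 2) * Real.sqrt Q ^ n = ρ ^ n := by
    rw [hρ, ← Real.rpow_natCast, ← Real.rpow_natCast, ← Real.rpow_natCast,
      ← Real.rpow_neg_one, ← Real.rpow_mul hs.le, ← Real.rpow_mul hs.le, ← Real.rpow_mul hs.le,
      ← Real.rpow_add hs]
    congr 1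
    ring
  calc _ = B ^ (r / 2) * (((n : ℝ) + 1) ^ 2) ^ (r / 2) * (n + 2) *
        (((Real.sqrt Q)⁻¹ ^ n) ^ (r / 2) * Real.sqrt Q ^ n) := by ring
    _ ≤ B ^ (r / 2) * ((n : ℝ) + 1) ^ N * (2 * (n + 1)) * ρ ^ n := by
        rw [e2]
        gcongr
        linarith
    _ = _ := by
        push_cast
        field_simp
        ring

theorem rpow_tsum_propagate_le {Q : ℕ} (hQ : 2 ≤ Q) (T : HomTree Q) {r q p s : ℝ}
    (hr : 2 < r) (hrq : r ≤ q) (hs : 0 < s) (hp : p = r / (r - 1)) (hsp : s ≤ p) {B τ : ℝ}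
    (hτ : 0 ≤ τ) {t : ℝ}
    (hker : ∀ n : ℕ, ‖schKernel Q t n‖ ≤ B * τ * (n + 1) ^ 2 * (Real.sqrt Q)⁻¹ ^ n)
    (f : T.V → ℂ) :
    (∑' x, ‖propagate T t f x‖ₑ ^ q) ^ (1 / q) ≤
      (∑' n : ℕ, ENNReal.ofReal (B * (n + 1) ^ 2 * (Real.sqrt Q)⁻¹ ^ n) ^ (r / 2) *
        ((n + 2) * sqrtENN Q ^ n)) ^ (2 / r) * ENNReal.ofReal τ *
        (∑' x, ‖f x‖ₑ ^ s) ^ (1 / s) := by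
  have hr0 : 0 < r := by linarith
  have hr1 : 0 < r - 1 := by linarith
  obtain ⟨o⟩ := T.isTree.connected.nonempty
  set A₁ := ∑' n : ℕ, ENNReal.ofReal (B * (n + 1) ^ 2 * (Real.sqrt Q)⁻¹ ^ n) ^ (r / 2) *
    ((n + 2) * sqrtENN Q ^ n) with hA₁
  set A := ENNReal.ofReal τ ^ (r / 2) * A₁ with hA
  have hschur : ∀ x, ∑' y, ‖schKernel Q t (T.graph.dist x y)‖ₑ ^ (r / 2) * T.weight o y ≤
      A * T.weight o x := by
    intro x
    refine (T.tsum_radial_weight_le hQ (fun n => ‖schKernel Q t n‖ₑ ^ (r / 2)) o x).trans ?_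
    gcongr
    rw [hA, hA₁, ← ENNReal.tsum_mul_left]
    refine ENNReal.tsum_le_tsum fun n => ?_
    rw [← mul_assoc (ENNReal.ofReal τ ^ (r / 2)),
      ← ENNReal.mul_rpow_of_nonneg _ _ (by positivity : 0 ≤ r / 2), ← ENNReal.ofReal_mul hτ]
    gcongr
    rw [← ofReal_norm]
    refine ENNReal.ofReal_le_ofReal ((hker n).trans (le_of_eq ?_))
    ring
  have h1 := tsum_schur_rpow_le hr hp
    (K := fun x y => ‖schKernel Q t (T.graph.dist x y)‖ₑ)
    (fun x y => by rw [SimpleGraph.dist_comm]) (fun x => T.weight_ne_zero o x)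
    (fun x => T.weight_ne_top hQ o x) hschur (fun y => ‖f y‖ₑ)
  calc _ ≤ (∑' x, ‖propagate T t f x‖ₑ ^ r) ^ (1 / r) :=
        tsum_rpow_rpow_inv_anti hr0 hrq fun x => ‖propagate T t f x‖ₑ
    _ ≤ (A ^ (2 : ℝ) * (∑' y, ‖f y‖ₑ ^ p) ^ (r - 1)) ^ (1 / r) := by
        refine ENNReal.rpow_le_rpow (le_trans ?_ h1) (by positivity)
        gcongr with x
        exact enorm_propagate_le T t f x
    _ = A₁ ^ (2 / r) * ENNReal.ofReal τ * (∑' y, ‖f y‖ₑ ^ p) ^ (1 / p) := by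
        rw [ENNReal.mul_rpow_of_nonneg _ _ (by positivity), ← ENNReal.rpow_mul,
          ← ENNReal.rpow_mul, hA, ENNReal.mul_rpow_of_nonneg _ _ (by positivity),
          ← ENNReal.rpow_mul]
        have h2 : r / 2 * (2 * (1 / r)) = 1 := by field_simp
        have h3 : (r - 1) * (1 / r) = 1 / p := by rw [hp]; field_simp
        rw [h2, h3, ENNReal.rpow_one, mul_one_div, mul_comm (ENNReal.ofReal τ)]
    _ ≤ _ := by
        gcongr
        exact tsum_rpow_rpow_inv_anti hs hsp fun x => ‖f x‖ₑ

/-- Non-admissible dispersive estimate: for `2 < q, q̃ < ∞` and `q̃'` the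
conjugate exponent of `q̃`, `‖e^{itℒ}f‖_{L^q} ≲ ‖f‖_{L^{q̃'}}` for `|t| ≤ 1` and
`‖e^{itℒ}f‖_{L^q} ≲ |t|^{-3/2} ‖f‖_{L^{q̃'}}` for `|t| ≥ 1`. -/
theorem dispersive_estimate_two_exponents (Q : ℕ) (hQ : 2 ≤ Q) (T : HomTree Q)
    (q tq tq' : ℝ≥0∞) (hq : 2 < q) (hq' : q < ∞) (htq : 2 < tq) (htq' : tq < ∞)
    (hconj : tq⁻¹ + tq'⁻¹ = 1) :
    ∃ C : ℝ≥0, 0 < C ∧ ∀ (t : ℝ) (f : T.V → ℂ),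
      (|t| ≤ 1 → spaceNorm T q (propagate T t f) ≤ (C : ℝ≥0∞) * spaceNorm T tq' f) ∧
      (1 ≤ |t| → spaceNorm T q (propagate T t f) ≤
        (C : ℝ≥0∞) * ENNReal.ofReal (|t| ^ (-(3 / 2) : ℝ)) * spaceNorm T tq' f) := by
  have hqt : q ≠ ∞ := hq'.ne
  have htqt : tq ≠ ∞ := htq'.ne
  have hq2 : 2 < q.toReal := by simpa using (ENNReal.toReal_lt_toReal (by simp) hqt).2 hq
  have htq2 : 2 < tq.toReal := by simpa using (ENNReal.toReal_lt_toReal (by simp) htqt).2 htq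
  have htq0 : tq ≠ 0 := (zero_le.trans_lt htq).ne'
  have htqr0 : 0 < tq.toReal := by linarith
  have hpt : tq' ≠ ∞ := by
    rintro rfl
    rw [ENNReal.inv_top, add_zero, ENNReal.inv_eq_one] at hconj
    rw [hconj] at htq2
    norm_num at htq2
  have hp0 : tq' ≠ 0 := by
    rintro rfl
    simp at hconj
  have hpr0 : 0 < tq'.toReal := ENNReal.toReal_pos hp0 hpt
  have hconjr : tq.toReal⁻¹ + tq'.toReal⁻¹ = 1 := by
    have h := congrArg ENNReal.toReal hconj
    rwa [ENNReal.toReal_add (ENNReal.inv_ne_top.2 htq0) (ENNReal.inv_ne_top.2 hp0),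
      ENNReal.toReal_inv, ENNReal.toReal_inv, ENNReal.toReal_one] at h
  set r := min q.toReal tq.toReal with hr
  have hr2 : 2 < r := lt_min hq2 htq2
  have hr1 : 0 < r - 1 := by linarith
  have hsp : tq'.toReal ≤ r / (r - 1) := by
    have h1 : r⁻¹ ≥ tq.toReal⁻¹ := by
      gcongr
      exact min_le_right _ _
    have h2 : (r / (r - 1))⁻¹ ≤ tq'.toReal⁻¹ := by
      have h3 : (r / (r - 1))⁻¹ = 1 - r⁻¹ := by field_simp
      rw [h3]; linarith
    exact (inv_le_inv₀ (by positivity) hpr0).1 h2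
  obtain ⟨B, hB, hker⟩ := norm_schKernel_le hQ
  set A := (∑' n : ℕ, ENNReal.ofReal (B * (n + 1) ^ 2 * (Real.sqrt Q)⁻¹ ^ n) ^ (r / 2) *
    ((n + 2) * sqrtENN Q ^ n)) ^ (2 / r) with hA
  have hAtop : A ≠ ∞ :=
    ENNReal.rpow_ne_top_of_nonneg (by positivity) (tsum_kernel_majorant_ne_top hQ hB hr2)
  have hAC : A ≤ ((A.toNNReal + 1 : ℝ≥0) : ℝ≥0∞) := by
    rw [ENNReal.coe_add, ENNReal.coe_toNNReal hAtop]
    exact le_self_add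
  have main : ∀ (t τ : ℝ) (f : T.V → ℂ), 0 ≤ τ →
      (∀ n : ℕ, ‖schKernel Q t n‖ ≤ B * τ * (n + 1) ^ 2 * (Real.sqrt Q)⁻¹ ^ n) →
      spaceNorm T q (propagate T t f) ≤
        ((A.toNNReal + 1 : ℝ≥0) : ℝ≥0∞) * ENNReal.ofReal τ * spaceNorm T tq' f := by
    intro t τ f hτ h
    rw [spaceNorm, spaceNorm, if_neg hqt, if_neg hpt]
    refine (rpow_tsum_propagate_le hQ T hr2 (min_le_left _ _) hpr0 rfl hsp hτ h f).trans ?_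
    exact mul_le_mul_left (mul_le_mul_left hAC _) _
  refine ⟨A.toNNReal + 1, by positivity, fun t f => ⟨fun _ => ?_, fun ht => ?_⟩⟩
  · simpa using main t 1 f zero_le_one fun n => by simpa using (hker t n).1
  · exact main t _ f (by positivity) fun n =>
      (hker t n).2 (abs_pos.1 (zero_lt_one.trans_le ht))
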